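/- Let n be a positive integer, 0 < Γ < 1, γ ∈ ℝ, and α₁,…,α_n, β₁,…,β_n ∈ [0,1] satisfy the (P1) constraints: γ ≥ Γ; Σ_{i=1}^{n}(α_i+β_i) ≥ 2Γn + 2·Σ_{i=1}^{n} max(0, Γ − (1−e^{α_i−1}) − (1−e^{β_i−1})); for every i ∈ {1,…,n}, Σ_{j=1}^{i−1} α_j + (n−i+1)·α_i ≤ Σ_{j=1}^{i} β_j + n·γ; and Σ_{i=1}^{n} α_i ≥ n·γ + Σ_{i=1}^{n} β_i. Suppose for some index i we have α_i > 0, β_i > 0, and (1−e^{α_i−1}) + (1−e^{β_i−1}) < Γ. Then for all sufficiently small ε > 0, replacing α_i by α_i − ε and β_i by β_i − ε yields numbers that again satisfy all the (P1) constraints above. -/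

import Mathlib

open Finset Real

/-- The constraints of the optimization problem (P1) (including `α_i, β_i ∈ [0,1]`). -/
def P1Constraints (n : ℕ) (Γ γ : ℝ) (α β : ℕ → ℝ) : Prop :=
  (∀ i ∈ Finset.Icc 1 n, α i ∈ Set.Icc (0:ℝ) 1 ∧ β i ∈ Set.Icc (0:ℝ) 1) ∧
  Γ ≤ γ ∧
  2 * Γ * n + 2 * ∑ i ∈ Finset.Icc 1 n,
      max 0 (Γ - (1 - Real.exp (α i - 1)) - (1 - Real.exp (β i - 1)))
    ≤ ∑ i ∈ Finset.Icc 1 n, (α i + β i) ∧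
  (∀ i ∈ Finset.Icc 1 n,
    (∑ j ∈ Finset.Icc 1 (i - 1), α j) + ((n:ℝ) - i + 1) * α i
      ≤ (∑ j ∈ Finset.Icc 1 i, β j) + n * γ) ∧
  n * γ + ∑ i ∈ Finset.Icc 1 n, β i ≤ ∑ i ∈ Finset.Icc 1 n, α i

/-- Subtracting `ε` from the value at one point subtracts `ε` from the sum over any finset
containing that point and leaves the other sums unchanged. -/
theorem sum_update_sub {ι : Type*} [DecidableEq ι] (s : Finset ι) (f : ι → ℝ) (i : ι) (ε : ℝ) :
    ∑ j ∈ s, Function.update f i (f i - ε) j = ∑ j ∈ s, f j - if i ∈ s then ε else 0 := by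
  have h : ∀ j, Function.update f i (f i - ε) j = f j - if i = j then ε else 0 := by
    intro j
    by_cases hj : i = j
    · subst hj; simp
    · simp [hj, Ne.symm hj]
  simp only [h, Finset.sum_sub_distrib, Finset.sum_ite_eq]

/-- If `exp a + exp b ≥ 1 + ε`, then shifting both exponents down by `ε ≥ 0` decreases the sum of
the exponentials by at least `ε`. -/
theorem exp_sub_add_exp_sub_le {a b ε : ℝ} (hε : 0 ≤ ε) (h : 1 + ε ≤ exp a + exp b) :
    exp (a - ε) + exp (b - ε) ≤ exp a + exp b - ε := by
  have hexp := Real.add_one_le_exp ε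
  rw [Real.exp_sub, Real.exp_sub, ← add_div, div_le_iff₀ (Real.exp_pos ε)]
  nlinarith

/-- **Slack constraints of (P1) can be tightened by decreasing `α_i, β_i`.**
If a feasible solution of (P1) has an index `i₀` with `α_{i₀} > 0`, `β_{i₀} > 0` and
`(1−e^{α_{i₀}−1}) + (1−e^{β_{i₀}−1}) < Γ`, then for all sufficiently small `ε > 0`,
decreasing both `α_{i₀}` and `β_{i₀}` by `ε` keeps all (P1) constraints satisfied. -/
theorem P1_decrease_feasible
    (n : ℕ) (hn : 0 < n) (Γ γ : ℝ) (hΓ0 : 0 < Γ) (hΓ1 : Γ < 1)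
    (α β : ℕ → ℝ)
    (hfeas : P1Constraints n Γ γ α β)
    (i₀ : ℕ) (hi₀ : i₀ ∈ Finset.Icc 1 n)
    (hα : 0 < α i₀) (hβ : 0 < β i₀)
    (hslack : (1 - Real.exp (α i₀ - 1)) + (1 - Real.exp (β i₀ - 1)) < Γ) :
    ∃ ε₀ > 0, ∀ ε : ℝ, 0 < ε → ε ≤ ε₀ →
      P1Constraints n Γ γ
        (Function.update α i₀ (α i₀ - ε))
        (Function.update β i₀ (β i₀ - ε)) := by
  obtain ⟨hbox, hγ, hsum, hpre, htot⟩ := hfeas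
  have hx : 0 < Γ - (1 - exp (α i₀ - 1)) - (1 - exp (β i₀ - 1)) := by linarith
  refine ⟨min (min (α i₀) (β i₀)) (Γ - (1 - exp (α i₀ - 1)) - (1 - exp (β i₀ - 1))),
    lt_min (lt_min hα hβ) hx, fun ε hε hle => ?_⟩
  obtain ⟨hle, hεx⟩ := le_min_iff.1 hle
  obtain ⟨hεα, hεβ⟩ := le_min_iff.1 hle
  refine ⟨fun i hi => ?_, hγ, ?_, fun i hi => ?_, ?_⟩
  · obtain ⟨⟨hα0, hα1⟩, hβ0, hβ1⟩ := hbox i hi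
    by_cases h : i = i₀
    · subst h
      simp only [Function.update_self, Set.mem_Icc]
      refine ⟨⟨?_, ?_⟩, ?_, ?_⟩ <;> linarith
    · simp only [Function.update_of_ne h, Set.mem_Icc]
      exact ⟨⟨hα0, hα1⟩, hβ0, hβ1⟩
  · have hmax : ∑ i ∈ Finset.Icc 1 n,
        max 0 (Γ - (1 - exp (Function.update α i₀ (α i₀ - ε) i - 1))
          - (1 - exp (Function.update β i₀ (β i₀ - ε) i - 1)))
        ≤ ∑ i ∈ Finset.Icc 1 n, (max 0 (Γ - (1 - exp (α i - 1)) - (1 - exp (β i - 1)))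
          - if i₀ = i then ε else 0) := by
      refine Finset.sum_le_sum fun i _ => ?_
      by_cases h : i₀ = i
      · subst h
        have hdec := exp_sub_add_exp_sub_le (a := α i₀ - 1) (b := β i₀ - 1) hε.le (by linarith)
        simp only [Function.update_self, if_true, max_eq_right hx.le, sub_right_comm _ ε 1]
        exact max_le (by linarith) (by linarith)
      · simp [h, Function.update_of_ne (Ne.symm h)]
    rw [Finset.sum_sub_distrib, Finset.sum_ite_eq, if_pos hi₀] at hmax
    rw [Finset.sum_add_distrib] at hsum
    rw [Finset.sum_add_distrib, sum_update_sub, sum_update_sub, if_pos hi₀]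
    linarith
  · have hi' := hpre i hi
    rw [Finset.mem_Icc] at hi hi₀
    rw [sum_update_sub, sum_update_sub]
    rcases lt_trichotomy i i₀ with h | h | h
    · rw [if_neg (by rw [Finset.mem_Icc]; omega), if_neg (by rw [Finset.mem_Icc]; omega),
        Function.update_of_ne h.ne]
      linarith
    · subst h
      have hin : (i : ℝ) ≤ n := by exact_mod_cast hi.2
      rw [if_neg (by rw [Finset.mem_Icc]; omega), if_pos (by rw [Finset.mem_Icc]; omega),
        Function.update_self]
      nlinarith
    · rw [if_pos (by rw [Finset.mem_Icc]; omega), if_pos (by rw [Finset.mem_Icc]; omega),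
        Function.update_of_ne h.ne']
      linarith
  · rw [sum_update_sub, sum_update_sub, if_pos hi₀]
    linarith
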